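/- Let m,n,p ≥ 3 and, over the three-letter alphabet {a,b,c}, let K₁ = L(X_m(a,b,−;{c})), K₂ = L(X_n(b,a,c;∅)), K₃ = L(X_p(b,−,c;{a})). Then the state complexity of K₁·(K₂ ∩ K₃) equals (m−1)·2^{np} + 2^{np−1}. -/

import Mathlib

/-- The cyclic permutation `i ↦ i+1 mod n` on `{0,…,n−1}`. -/
def cyc {n : ℕ} (i : Fin n) : Fin n := ⟨(i.val + 1) % n, Nat.mod_lt _ i.pos⟩

/-- The transposition exchanging `0` and `1` and fixing all other elements of `{0,…,n−1}`. -/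
def transp {n : ℕ} (i : Fin n) : Fin n :=
  if i.val = 0 then ⟨1 % n, Nat.mod_lt _ i.pos⟩
  else if i.val = 1 then ⟨0, i.pos⟩ else i

/-- The contraction sending `1` to `0` and fixing all other elements of `{0,…,n−1}`. -/
def contr {n : ℕ} (i : Fin n) : Fin n := if i.val = 1 then ⟨0, i.pos⟩ else i

/-- A Brzozowski-type complete DFA: state set `{0,…,n−1}`, initial state `0`,
unique final state `n−1`, where each letter `x` acts as the transformation `f x`. -/
def brzDFA {α : Type} (n : ℕ) (hn : 0 < n) (f : α → Fin n → Fin n) : DFA α (Fin n) where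
  step q x := f x q
  start := ⟨0, hn⟩
  accept := {⟨n - 1, Nat.sub_lt hn Nat.one_pos⟩}

/-- The state complexity of a language: the least number of states of a complete
DFA recognizing it. -/
noncomputable def sc {α : Type} (L : Language α) : ℕ :=
  sInf {n | ∃ M : DFA α (Fin n), M.accepts = L}

/-- The three-letter alphabet `{a,b,c}`. -/
inductive ABC | a | b | c

/-- `X_m(a,b,−;{c})`: `a` the cycle, `b` the transposition, `c` the identity. -/
def XA (m : ℕ) (hm : 0 < m) : DFA ABC (Fin m) :=
  brzDFA m hm (fun x q => match x with | ABC.a => cyc q | ABC.b => transp q | ABC.c => q)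

/-- `X_n(b,a,c;∅)`: `b` the cycle, `a` the transposition, `c` the contraction. -/
def XB (n : ℕ) (hn : 0 < n) : DFA ABC (Fin n) :=
  brzDFA n hn (fun x q => match x with | ABC.a => transp q | ABC.b => cyc q | ABC.c => contr q)

/-- `X_p(b,−,c;{a})`: `b` the cycle, `c` the contraction, `a` the identity. -/
def XC (p : ℕ) (hp : 0 < p) : DFA ABC (Fin p) :=
  brzDFA p hp (fun x q => match x with | ABC.a => q | ABC.b => cyc q | ABC.c => contr q)

/-! ### State complexity of a minimal automaton -/

section Generic

variable {α σ τ : Type}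

/-- Two states are distinguishable if some word is accepted from exactly one of them. -/
def Distinguishable (M : DFA α σ) (s t : σ) : Prop :=
  ∃ w, ¬(M.evalFrom s w ∈ M.accept ↔ M.evalFrom t w ∈ M.accept)

theorem Distinguishable.symm {M : DFA α σ} {s t : σ} (h : Distinguishable M s t) :
    Distinguishable M t s := by
  obtain ⟨w, hw⟩ := h
  exact ⟨w, fun h => hw h.symm⟩

theorem Distinguishable.of_step {M : DFA α σ} {s t : σ} (x : α)
    (h : Distinguishable M (M.step s x) (M.step t x)) : Distinguishable M s t := by
  obtain ⟨w, hw⟩ := h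
  exact ⟨x :: w, hw⟩

/-- If `V` is the set of reachable states of `M` and its elements are pairwise
distinguishable, then the language of `M` has state complexity `V.card`. -/
theorem sc_accepts_eq_card (M : DFA α σ) (V : Finset σ) (hV : ∀ w, M.eval w ∈ V)
    (reach : ∀ v ∈ V, ∃ w, M.eval w = v)
    (sep : ∀ s ∈ V, ∀ t ∈ V, s ≠ t → Distinguishable M s t) :
    sc M.accepts = V.card := by
  have mem : ∃ N : DFA α (Fin V.card), N.accepts = M.accepts := by
    have hstep : ∀ v ∈ V, ∀ x, M.step v x ∈ V := by
      intro v hv x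
      obtain ⟨w, rfl⟩ := reach v hv
      rw [← DFA.eval_append_singleton]
      exact hV _
    let N : DFA α V :=
      { step := fun v x => ⟨M.step v x, hstep v v.2 x⟩
        start := ⟨M.start, hV []⟩
        accept := {v | (v : σ) ∈ M.accept} }
    have hN : ∀ w, (N.eval w : σ) = M.eval w := by
      intro w
      induction w using List.reverseRecOn with
      | nil => rfl
      | append_singleton w x ih => simp only [DFA.eval_append_singleton, ← ih, N]
    refine ⟨DFA.reindex V.equivFin N, ?_⟩
    rw [DFA.accepts_reindex]
    ext w
    change (N.eval w : σ) ∈ M.accept ↔ M.eval w ∈ M.accept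
    rw [hN]
  refine le_antisymm (Nat.sInf_le mem) (le_csInf ⟨_, mem⟩ ?_)
  rintro k ⟨N, hN⟩
  choose f hf using fun v : V => reach v v.2
  have inj : Function.Injective fun v : V => N.eval (f v) := by
    intro s t hst
    by_contra hne
    obtain ⟨w, hw⟩ := sep s s.2 t t.2 (fun h => hne (Subtype.ext h))
    apply hw
    have key : ∀ v : V, M.evalFrom v w ∈ M.accept ↔ N.evalFrom (N.eval (f v)) w ∈ N.accept := by
      intro v
      have h : f v ++ w ∈ N.accepts ↔ f v ++ w ∈ M.accepts := by rw [hN]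
      rw [DFA.mem_accepts, DFA.mem_accepts, DFA.eval, DFA.eval, DFA.evalFrom_of_append,
        DFA.evalFrom_of_append] at h
      rw [← hf v]
      exact h.symm
    rw [key s, key t]
    simp only at hst
    rw [hst]
  simpa using Fintype.card_le_of_injective _ inj

open Classical in
/-- The subset automaton of a concatenation: a state records the state of the first automaton
and the set of states reached by the copies of the second automaton launched so far. -/
noncomputable def catDFA (A : DFA α σ) (B : DFA α τ) : DFA α (σ × Finset τ) where
  step s x := (A.step s.1 x,
    s.2.image (B.step · x) ∪ if A.step s.1 x ∈ A.accept then {B.start} else ∅)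
  start := (A.start, if A.start ∈ A.accept then {B.start} else ∅)
  accept := {s | ∃ t ∈ s.2, t ∈ B.accept}

theorem mem_catDFA_step {A : DFA α σ} {B : DFA α τ} {s : σ × Finset τ} {x : α} {t : τ} :
    t ∈ ((catDFA A B).step s x).2 ↔
      (∃ u ∈ s.2, B.step u x = t) ∨ (A.step s.1 x ∈ A.accept ∧ t = B.start) := by
  simp only [catDFA, Finset.mem_union, Finset.mem_image]
  split_ifs with h <;> simp [h]

theorem catDFA_eval_fst (A : DFA α σ) (B : DFA α τ) (w : List α) :
    ((catDFA A B).eval w).1 = A.eval w := by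
  induction w using List.reverseRecOn with
  | nil => rfl
  | append_singleton w x ih =>
    rw [DFA.eval_append_singleton, DFA.eval_append_singleton, ← ih]
    rfl

theorem mem_catDFA_eval {A : DFA α σ} {B : DFA α τ} {w : List α} {t : τ} :
    t ∈ ((catDFA A B).eval w).2 ↔ ∃ u v, u ++ v = w ∧ A.eval u ∈ A.accept ∧ B.eval v = t := by
  induction w using List.reverseRecOn generalizing t with
  | nil =>
    simp only [DFA.eval_nil, catDFA, List.append_eq_nil_iff]
    constructor
    · intro h
      split_ifs at h with h'
      · exact ⟨[], [], ⟨rfl, rfl⟩, h', (Finset.mem_singleton.1 h).symm⟩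
      · simp at h
    · rintro ⟨u, v, ⟨rfl, rfl⟩, h, rfl⟩
      rw [DFA.eval_nil] at h
      simp [h]
  | append_singleton w x ih =>
    rw [DFA.eval_append_singleton, mem_catDFA_step, catDFA_eval_fst,
      ← DFA.eval_append_singleton]
    constructor
    · rintro (⟨r, hr, rfl⟩ | ⟨h, rfl⟩)
      · obtain ⟨u, v, rfl, hu, rfl⟩ := ih.1 hr
        exact ⟨u, v ++ [x], by simp, hu, by simp⟩
      · exact ⟨w ++ [x], [], by simp, h, rfl⟩
    · rintro ⟨u, v, huv, hu, rfl⟩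
      rcases List.eq_nil_or_concat v with rfl | ⟨v, y, rfl⟩
      · right
        rw [List.append_nil] at huv
        exact ⟨huv ▸ hu, rfl⟩
      · left
        rw [List.concat_eq_append, ← List.append_assoc] at huv
        obtain ⟨rfl, h⟩ := List.append_inj' huv rfl
        obtain rfl : y = x := by simpa using h
        exact ⟨B.eval v, ih.2 ⟨u, v, rfl, hu, rfl⟩, by simp⟩

theorem catDFA_accepts (A : DFA α σ) (B : DFA α τ) :
    (catDFA A B).accepts = A.accepts * B.accepts := by
  ext w
  rw [DFA.mem_accepts, Language.mem_mul]
  change (∃ t ∈ ((catDFA A B).eval w).2, t ∈ B.accept) ↔ _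
  simp only [mem_catDFA_eval, DFA.mem_accepts]
  grind

end Generic

/-! ### The elementary transformations -/

section Transformations

variable {n : ℕ}

theorem cyc_mk {k : ℕ} (h : k + 1 < n) :
    cyc (⟨k, by omega⟩ : Fin n) = ⟨k + 1, h⟩ :=
  Fin.ext (Nat.mod_eq_of_lt h)

theorem cyc_last (h : 0 < n) : cyc (⟨n - 1, by omega⟩ : Fin n) = ⟨0, h⟩ := by
  apply Fin.ext
  change (n - 1 + 1) % n = 0
  rw [Nat.sub_add_cancel h, Nat.mod_self]

theorem cyc_surjective : Function.Surjective (cyc : Fin n → Fin n) := by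
  rintro ⟨k, hk⟩
  rcases k with _ | k
  · exact ⟨_, cyc_last hk⟩
  · exact ⟨_, cyc_mk hk⟩

theorem cyc_injective : Function.Injective (cyc : Fin n → Fin n) :=
  Finite.injective_iff_surjective.2 cyc_surjective

theorem transp_zero (h : 1 < n) : transp (⟨0, by omega⟩ : Fin n) = ⟨1, h⟩ := by
  simp [transp, Nat.mod_eq_of_lt h]

theorem transp_one (h : 1 < n) : transp (⟨1, h⟩ : Fin n) = ⟨0, by omega⟩ := by
  simp [transp]

theorem transp_of_two_le {i : Fin n} (h : 2 ≤ i.val) : transp i = i := by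
  simp [transp, show i.val ≠ 0 by omega, show i.val ≠ 1 by omega]

theorem transp_transp (h : 1 < n) (i : Fin n) : transp (transp i) = i := by
  obtain ⟨k, hk⟩ := i
  match k, hk with
  | 0, _ => rw [transp_zero h, transp_one h]
  | 1, _ => rw [transp_one h, transp_zero h]
  | k + 2, hk =>
    have h2 : 2 ≤ (⟨k + 2, hk⟩ : Fin n).val := Nat.le_add_left 2 k
    rw [transp_of_two_le h2, transp_of_two_le h2]

theorem contr_val_ne_one (i : Fin n) : (contr i).val ≠ 1 := by
  unfold contr
  split_ifs with h
  · simp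
  · exact h

/-- The cycle acts transitively. -/
theorem cyc_induction {P : Fin n → Prop} (i₀ : Fin n) (h₀ : P i₀)
    (step : ∀ i, P i → P (cyc i)) (i : Fin n) : P i := by
  have hpos : 0 < n := i.pos
  have up : ∀ k l (hl : k + l < n), P ⟨k, by omega⟩ → P ⟨k + l, hl⟩ := by
    intro k l
    induction l with
    | zero => exact fun _ h => h
    | succ l ih =>
      intro hl h
      have := step _ (ih (by omega) h)
      rwa [cyc_mk (by omega)] at this
  have hlast : P ⟨n - 1, by omega⟩ := by
    have := up i₀ (n - 1 - i₀) (by omega) h₀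
    convert this using 2
    omega
  have hzero : P ⟨0, hpos⟩ := cyc_last hpos ▸ step _ hlast
  have := up 0 i (by omega) hzero
  simpa using this

theorem cyc_induction_backward {P : Fin n → Prop} (i₀ : Fin n) (h₀ : P i₀)
    (step : ∀ i, P (cyc i) → P i) (i : Fin n) : P i := by
  by_contra hi
  exact cyc_induction (P := fun i => ¬P i) i hi (fun i h h' => h (step i h')) i₀ h₀

end Transformations

/-! ### The automaton of the concatenation -/

section Concatenation

/-- The action of a letter on the states of the first automaton. -/
def actState {m : ℕ} : ABC → Fin m → Fin m
  | ABC.a, q => cyc q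
  | ABC.b, q => transp q
  | ABC.c, q => q

/-- The action of a letter on the states of the intersection automaton. -/
def actPair {n p : ℕ} : ABC → Fin n × Fin p → Fin n × Fin p
  | ABC.a, t => (transp t.1, t.2)
  | ABC.b, t => (cyc t.1, cyc t.2)
  | ABC.c, t => (contr t.1, contr t.2)

theorem actState_surjective {m : ℕ} (hm : 1 < m) (x : ABC) :
    Function.Surjective (actState x : Fin m → Fin m) := by
  cases x
  · exact cyc_surjective
  · exact fun q => ⟨transp q, transp_transp hm q⟩
  · exact fun q => ⟨q, rfl⟩

theorem actState_injective {m : ℕ} (hm : 1 < m) (x : ABC) :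
    Function.Injective (actState x : Fin m → Fin m) :=
  Finite.injective_iff_surjective.2 (actState_surjective hm x)

theorem actPair_surjective {n p : ℕ} (hn : 1 < n) {x : ABC} (hx : x ≠ ABC.c) :
    Function.Surjective (actPair x : Fin n × Fin p → Fin n × Fin p) := by
  rintro ⟨i, j⟩
  cases x
  · exact ⟨(transp i, j), by simp [actPair, transp_transp hn]⟩
  · obtain ⟨i, rfl⟩ := cyc_surjective i
    obtain ⟨j, rfl⟩ := cyc_surjective j
    exact ⟨(i, j), rfl⟩
  · exact absurd rfl hx

theorem actPair_injective {n p : ℕ} (hn : 1 < n) {x : ABC} (hx : x ≠ ABC.c) :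
    Function.Injective (actPair x : Fin n × Fin p → Fin n × Fin p) :=
  Finite.injective_iff_surjective.2 (actPair_surjective hn hx)

theorem pos_of_three_le {k : ℕ} (h : 3 ≤ k) : 0 < k := Nat.zero_lt_of_lt h

/-- The final state of the first automaton. -/
def lastState {m : ℕ} (hm : 3 ≤ m) : Fin m := ⟨m - 1, by omega⟩

/-- The initial state of the intersection automaton. -/
def origin {n p : ℕ} (hn : 3 ≤ n) (hp : 3 ≤ p) : Fin n × Fin p :=
  (⟨0, pos_of_three_le ‹_›⟩, ⟨0, pos_of_three_le ‹_›⟩)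

theorem ne_origin {n p : ℕ} (hn : 3 ≤ n) (hp : 3 ≤ p) {i : Fin n} {j : Fin p}
    (h : i.val ≠ 0 ∨ j.val ≠ 0) : (i, j) ≠ origin hn hp := by
  intro h'
  simp only [origin, Prod.mk.injEq, Fin.ext_iff] at h'
  omega

variable {m n p : ℕ} (hm : 3 ≤ m) (hn : 3 ≤ n) (hp : 3 ≤ p)

/-- The subset automaton recognizing `K₁ · (K₂ ∩ K₃)`. -/
noncomputable def concatDFA : DFA ABC (Fin m × Finset (Fin n × Fin p)) :=
  catDFA (XA m (pos_of_three_le hm)) ((XB n (pos_of_three_le hn)).inter (XC p (pos_of_three_le hp)))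

theorem concatDFA_accepts :
    (concatDFA hm hn hp).accepts =
      (XA m (pos_of_three_le hm)).accepts *
        ((XB n (pos_of_three_le hn)).accepts ⊓ (XC p (pos_of_three_le hp)).accepts) := by
  rw [concatDFA, catDFA_accepts, DFA.accepts_inter]

theorem concatDFA_start : (concatDFA hm hn hp).start = (⟨0, pos_of_three_le ‹_›⟩, ∅) := by
  have h : (XA m (pos_of_three_le hm)).start ∉ (XA m (pos_of_three_le hm)).accept := by
    simp only [XA, brzDFA, Set.mem_singleton_iff, Fin.mk.injEq]
    omega
  simp only [concatDFA, catDFA, if_neg h]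
  rfl

theorem mem_concatDFA_accept {s : Fin m × Finset (Fin n × Fin p)} :
    s ∈ (concatDFA hm hn hp).accept ↔
      ((⟨n - 1, by omega⟩, ⟨p - 1, by omega⟩) : Fin n × Fin p) ∈ s.2 := by
  constructor
  · rintro ⟨⟨i, j⟩, ht, hi, hj⟩
    obtain rfl := Set.mem_singleton_iff.1 hi
    obtain rfl := Set.mem_singleton_iff.1 hj
    exact ht
  · exact fun h => ⟨_, h, rfl, rfl⟩

theorem concatDFA_step_fst (s : Fin m × Finset (Fin n × Fin p)) (x : ABC) :
    ((concatDFA hm hn hp).step s x).1 = actState x s.1 := by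
  cases x <;> rfl

theorem mem_concatDFA_step {s : Fin m × Finset (Fin n × Fin p)} {x : ABC} {t : Fin n × Fin p} :
    t ∈ ((concatDFA hm hn hp).step s x).2 ↔
      (∃ u ∈ s.2, actPair x u = t) ∨
        (actState x s.1 = lastState hm ∧ t = origin hn hp) := by
  cases x <;> exact mem_catDFA_step

/-! ### Distinguishability -/

/-- If `t` lies in the subset of a state but not in that of another state with first component `q`,
then the two states are distinguishable. -/
def Separates (q : Fin m) (t : Fin n × Fin p) : Prop :=
  ∀ (r : Fin m) (S T : Finset (Fin n × Fin p)), t ∈ S → t ∉ T →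
    Distinguishable (concatDFA hm hn hp) (r, S) (q, T)

variable {hm hn hp}

theorem Separates.of_act {q : Fin m} {t : Fin n × Fin p} (x : ABC) (hx : x ≠ ABC.c)
    (h : Separates hm hn hp (actState x q) (actPair x t))
    (h' : actState x q ≠ lastState hm ∨ actPair x t ≠ origin hn hp) :
    Separates hm hn hp q t := by
  intro r S T hS hT
  refine .of_step x ?_
  rw [← Prod.mk.eta (p := (concatDFA hm hn hp).step (q, T) x), concatDFA_step_fst]
  refine h _ _ _ ?_ ?_
  · exact (mem_concatDFA_step hm hn hp).2 (.inl ⟨t, hS, rfl⟩)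
  · intro hmem
    rcases (mem_concatDFA_step hm hn hp).1 hmem with ⟨u, hu, hut⟩ | ⟨h1, h2⟩
    · exact hT (actPair_injective (by omega) hx hut ▸ hu)
    · exact h'.elim (· h1) (· h2)

theorem forall_separates_of_act {t : Fin n × Fin p} (x : ABC) (hx : x ≠ ABC.c)
    (h : ∀ q, Separates hm hn hp q (actPair x t)) (h' : actPair x t ≠ origin hn hp) (q : Fin m) :
    Separates hm hn hp q t :=
  .of_act x hx (h _) (.inr h')

theorem exists_separates_of_act {t : Fin n × Fin p} (x : ABC) (hx : x ≠ ABC.c)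
    (h : ∃ q, Separates hm hn hp q (actPair x t)) (h' : actPair x t ≠ origin hn hp) :
    ∃ q, Separates hm hn hp q t := by
  obtain ⟨q, hq⟩ := h
  obtain ⟨q, rfl⟩ := actState_surjective (by omega) x q
  exact ⟨q, .of_act x hx hq (.inr h')⟩

variable (hm hn hp)

theorem separates_final (q : Fin m) :
    Separates hm hn hp q (⟨n - 1, by omega⟩, ⟨p - 1, by omega⟩) := by
  intro r S T hS hT
  refine ⟨[], ?_⟩
  simp only [DFA.evalFrom_nil, mem_concatDFA_accept]
  tauto

/-- Each row contains a pair that separates in every state of the first automaton. -/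
theorem exists_separates_row (k : ℕ) (hk : k < n) :
    ∃ j : Fin p, ∀ q, Separates hm hn hp q (⟨n - 1 - k, by omega⟩, j) := by
  induction k with
  | zero => exact ⟨_, separates_final hm hn hp⟩
  | succ k ih =>
    obtain ⟨j, hj⟩ := ih (by omega)
    obtain ⟨j, rfl⟩ := cyc_surjective j
    have heq : actPair ABC.b ((⟨n - 1 - (k + 1), by omega⟩, j) : Fin n × Fin p) =
        (⟨n - 1 - k, by omega⟩, cyc j) := by
      simp only [actPair, cyc_mk (show n - 1 - (k + 1) + 1 < n by omega)]
      congr 2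
      omega
    refine ⟨j, forall_separates_of_act ABC.b (by simp) (heq ▸ hj) ?_⟩
    rw [heq]
    exact ne_origin hn hp (.inl (by simp only; omega))

theorem separates_origin (q : Fin m) : Separates hm hn hp q (origin hn hp) := by
  obtain ⟨⟨k, hk⟩, hj⟩ := exists_separates_row hm hn hp (n - 1) (by omega)
  simp only [Nat.sub_self] at hj
  induction k with
  | zero => exact hj q
  | succ k ih =>
    refine ih (by omega) ?_
    have h1 : ∀ q, Separates hm hn hp q (⟨1, by omega⟩, ⟨k + 1, hk⟩) := by
      refine forall_separates_of_act ABC.a (by simp) ?_ ?_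
      · simpa only [actPair, transp_one (show 1 < n by omega)] using hj
      · exact ne_origin hn hp (.inr (by simp))
    have heq : actPair ABC.b ((⟨0, pos_of_three_le ‹_›⟩, ⟨k, by omega⟩) : Fin n × Fin p) =
        (⟨1, by omega⟩, ⟨k + 1, hk⟩) := by
      simp only [actPair, cyc_mk hk, cyc_mk (show 0 + 1 < n by omega)]
    refine forall_separates_of_act ABC.b (by simp) (heq ▸ h1) ?_
    rw [heq]
    exact ne_origin hn hp (.inl (by simp))

theorem separates_zero_one_zero :
    Separates hm hn hp ⟨0, pos_of_three_le ‹_›⟩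
      (⟨1, by omega⟩, ⟨0, pos_of_three_le ‹_›⟩) := by
  refine .of_act ABC.a (by simp) ?_ (.inl ?_)
  · simp only [actPair, transp_one (show 1 < n by omega)]
    exact separates_origin hm hn hp _
  · simp only [actState, cyc_mk (show 0 + 1 < m by omega), lastState, ne_eq, Fin.mk.injEq]
    omega

theorem exists_separates_zero_of_one {j : Fin p}
    (h : ∃ q, Separates hm hn hp q (⟨1, by omega⟩, cyc j)) :
    ∃ q, Separates hm hn hp q (⟨0, pos_of_three_le ‹_›⟩, j) := by
  have heq : actPair ABC.b ((⟨0, pos_of_three_le ‹_›⟩, j) : Fin n × Fin p) =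
      (⟨1, by omega⟩, cyc j) := by
    simp only [actPair, cyc_mk (show 0 + 1 < n by omega)]
  refine exists_separates_of_act ABC.b (by simp) (heq ▸ h) ?_
  rw [heq]
  exact ne_origin hn hp (.inl (by simp))

theorem exists_separates_one (j : Fin p) :
    ∃ q, Separates hm hn hp q (⟨1, by omega⟩, j) := by
  refine cyc_induction_backward (P := fun j => ∃ q, Separates hm hn hp q (⟨1, by omega⟩, j))
    ⟨0, pos_of_three_le ‹_›⟩ ⟨_, separates_zero_one_zero hm hn hp⟩ ?_ j
  intro j hj
  rcases eq_or_ne j ⟨0, pos_of_three_le ‹_›⟩ with rfl | h0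
  · exact ⟨_, separates_zero_one_zero hm hn hp⟩
  · have heq : actPair ABC.a ((⟨1, by omega⟩, j) : Fin n × Fin p) =
        (⟨0, pos_of_three_le ‹_›⟩, j) := by
      simp only [actPair, transp_one (show 1 < n by omega)]
    refine exists_separates_of_act ABC.a (by simp)
      (heq ▸ exists_separates_zero_of_one hm hn hp hj) ?_
    rw [heq]
    exact ne_origin hn hp (.inr fun h => h0 (Fin.ext h))

theorem separates_last_row (j : Fin p) (q : Fin m) :
    Separates hm hn hp q (⟨n - 1, by omega⟩, j) := by
  have heq : actPair ABC.b ((⟨n - 1, by omega⟩, j) : Fin n × Fin p) =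
      (⟨0, pos_of_three_le ‹_›⟩, cyc j) := by
    simp only [actPair, cyc_last (show 0 < n by omega)]
  have hfix : actPair ABC.a ((⟨n - 1, by omega⟩, j) : Fin n × Fin p) =
      (⟨n - 1, by omega⟩, j) := by
    simp only [actPair]
    rw [transp_of_two_le (by simp only; omega)]
  have hex : ∃ q, Separates hm hn hp q (⟨n - 1, by omega⟩, j) := by
    by_cases h0 : cyc j = ⟨0, pos_of_three_le ‹_›⟩
    · refine ⟨⟨0, pos_of_three_le ‹_›⟩, .of_act ABC.b (by simp) ?_ (.inl ?_)⟩
      · rw [heq, h0]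
        exact separates_origin hm hn hp _
      · simp only [actState, transp_zero (show 1 < m by omega), lastState, ne_eq, Fin.mk.injEq]
        omega
    · refine exists_separates_of_act ABC.b (by simp) ?_ ?_
      · rw [heq]
        exact exists_separates_zero_of_one hm hn hp (exists_separates_one hm hn hp _)
      · rw [heq]
        exact ne_origin hn hp (.inr fun h => h0 (Fin.ext h))
  obtain ⟨r, hr⟩ := hex
  refine cyc_induction_backward (P := fun q => Separates hm hn hp q (⟨n - 1, by omega⟩, j))
    r hr (fun q hq => .of_act ABC.a (by simp) (by rwa [hfix]) (.inr ?_)) q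
  rw [hfix]
  exact ne_origin hn hp (.inl (by simp only; omega))

theorem separates_row (k : ℕ) (hk : k < n) (j : Fin p) (q : Fin m) :
    Separates hm hn hp q (⟨n - 1 - k, by omega⟩, j) := by
  induction k generalizing j q with
  | zero => exact separates_last_row hm hn hp j q
  | succ k ih =>
    have heq : actPair ABC.b ((⟨n - 1 - (k + 1), by omega⟩, j) : Fin n × Fin p) =
        (⟨n - 1 - k, by omega⟩, cyc j) := by
      simp only [actPair, cyc_mk (show n - 1 - (k + 1) + 1 < n by omega)]
      congr 2
      omega
    refine forall_separates_of_act ABC.b (by simp) ?_ ?_ q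
    · rw [heq]
      exact ih (by omega) _
    · rw [heq]
      exact ne_origin hn hp (.inl (by simp only; omega))

theorem separates (q : Fin m) (t : Fin n × Fin p) : Separates hm hn hp q t := by
  obtain ⟨⟨i, hi⟩, j⟩ := t
  have := separates_row hm hn hp (n - 1 - i) (by omega) j q
  simpa only [show n - 1 - (n - 1 - i) = i by omega] using this

theorem distinguishable_of_snd_ne {q r : Fin m} {S T : Finset (Fin n × Fin p)} (h : S ≠ T) :
    Distinguishable (concatDFA hm hn hp) (q, S) (r, T) := by
  by_cases hST : S ⊆ T
  · have hTS : ¬T ⊆ S := fun hTS => h (hST.antisymm hTS)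
    obtain ⟨t, hT, hS⟩ := Finset.not_subset.1 hTS
    exact (separates hm hn hp q t r T S hT hS).symm
  · obtain ⟨t, hS, hT⟩ := Finset.not_subset.1 hST
    exact separates hm hn hp r t q S T hS hT

theorem distinguishable_of_fst_ne {q r : Fin m} {S T : Finset (Fin n × Fin p)} (h : q ≠ r) :
    Distinguishable (concatDFA hm hn hp) (q, S) (r, T) := by
  revert r S T
  refine cyc_induction_backward (P := fun q => ∀ {r : Fin m} {S T : Finset (Fin n × Fin p)},
    q ≠ r → Distinguishable (concatDFA hm hn hp) (q, S) (r, T)) ⟨m - 2, by omega⟩ ?_ ?_ q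
  · intro r S T h
    have hcyc : cyc (⟨m - 2, by omega⟩ : Fin m) = lastState hm := by
      rw [cyc_mk (by omega)]
      exact Fin.ext (by simp only [lastState]; omega)
    refine .of_step ABC.c (.of_step ABC.a (distinguishable_of_snd_ne hm hn hp fun heq => ?_))
    have hS : origin hn hp ∈ ((concatDFA hm hn hp).step
        ((concatDFA hm hn hp).step (⟨m - 2, by omega⟩, S) ABC.c) ABC.a).2 :=
      (mem_concatDFA_step hm hn hp).2
        (.inr ⟨by simpa only [concatDFA_step_fst, actState] using hcyc, rfl⟩)
    replace heq : ((concatDFA hm hn hp).step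
        ((concatDFA hm hn hp).step (⟨m - 2, by omega⟩, S) ABC.c) ABC.a).2 =
        ((concatDFA hm hn hp).step ((concatDFA hm hn hp).step (r, T) ABC.c) ABC.a).2 := heq
    rw [heq, mem_concatDFA_step, concatDFA_step_fst] at hS
    rcases hS with ⟨u, hu, hut⟩ | ⟨h', -⟩
    · have hu1 : u.1 = ⟨1, by omega⟩ := by
        have h1 : transp u.1 = ⟨0, pos_of_three_le ‹_›⟩ := congrArg Prod.fst hut
        rw [← transp_transp (show 1 < n by omega) u.1, h1, transp_zero]
      rcases (mem_concatDFA_step hm hn hp).1 hu with ⟨v, -, rfl⟩ | ⟨-, rfl⟩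
      · exact contr_val_ne_one v.1 (congrArg Fin.val hu1)
      · simp [origin] at hu1
    · exact h (cyc_injective (hcyc.trans h'.symm))
  · intro q ih r S T h
    refine .of_step ABC.a ?_
    exact ih (cyc_injective.ne h)

/-! ### Reachability -/

/-- The pair `(q, S)` is a reachable state. -/
def Reachable (q : Fin m) (S : Finset (Fin n × Fin p)) : Prop :=
  ∃ w, (concatDFA hm hn hp).eval w = (q, S)

/-- The preimage of a set of states under the action of a letter. -/
def preAct (x : ABC) (S : Finset (Fin n × Fin p)) : Finset (Fin n × Fin p) :=
  Finset.univ.filter (actPair x · ∈ S)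

variable {hm hn hp}

theorem mem_preAct {x : ABC} {S : Finset (Fin n × Fin p)} {t : Fin n × Fin p} :
    t ∈ preAct x S ↔ actPair x t ∈ S := by
  simp [preAct]

theorem card_preAct (hn : 1 < n) {x : ABC} (hx : x ≠ ABC.c) (S : Finset (Fin n × Fin p)) :
    (preAct x S).card = S.card := by
  rw [← Finset.card_image_of_injective (preAct x S) (actPair_injective hn hx)]
  congr 1
  ext t
  obtain ⟨u, rfl⟩ := actPair_surjective hn hx t
  simp only [Finset.mem_image, mem_preAct]
  exact ⟨fun ⟨v, hv, h⟩ => h ▸ hv, fun h => ⟨u, h, rfl⟩⟩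

theorem Reachable.step {q : Fin m} {S : Finset (Fin n × Fin p)} (h : Reachable hm hn hp q S)
    (x : ABC) {T : Finset (Fin n × Fin p)}
    (hT : ∀ t, t ∈ T ↔ (∃ u ∈ S, actPair x u = t) ∨
      (actState x q = lastState hm ∧ t = origin hn hp)) :
    Reachable hm hn hp (actState x q) T := by
  obtain ⟨w, hw⟩ := h
  refine ⟨w ++ [x], ?_⟩
  rw [DFA.eval_append_singleton, hw]
  refine Prod.ext (concatDFA_step_fst hm hn hp _ _) (Finset.ext fun t => ?_)
  rw [mem_concatDFA_step, hT]

theorem Reachable.of_preAct {q : Fin m} {S : Finset (Fin n × Fin p)} {x : ABC} (hx : x ≠ ABC.c)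
    (h : Reachable hm hn hp q (preAct x S)) (hq : actState x q ≠ lastState hm) :
    Reachable hm hn hp (actState x q) S := by
  refine h.step x fun t => ?_
  obtain ⟨u, rfl⟩ := actPair_surjective (by omega) hx t
  simp only [mem_preAct, hq, false_and, or_false]
  exact ⟨fun h => ⟨u, h, rfl⟩, fun ⟨v, hv, h⟩ => h ▸ hv⟩

theorem Reachable.of_preAct_erase {q : Fin m} {S : Finset (Fin n × Fin p)} {x : ABC}
    (hx : x ≠ ABC.c) (h : Reachable hm hn hp q (preAct x (S.erase (origin hn hp))))
    (hS : origin hn hp ∈ S) (hq : actState x q = lastState hm) :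
    Reachable hm hn hp (actState x q) S := by
  refine h.step x fun t => ?_
  obtain ⟨u, rfl⟩ := actPair_surjective (by omega) hx t
  simp only [mem_preAct, hq, true_and, Finset.mem_erase]
  constructor
  · intro h
    by_cases h0 : actPair x u = origin hn hp
    · exact .inr h0
    · exact .inl ⟨u, ⟨h0, h⟩, rfl⟩
  · rintro (⟨v, ⟨-, hv⟩, h⟩ | h)
    · exact h ▸ hv
    · exact h ▸ hS

variable (hm hn hp)

/-- Every set with `k` elements containing `t` is reachable together with the state `0`. -/
def ReachableWith (k : ℕ) (t : Fin n × Fin p) : Prop :=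
  ∀ S : Finset (Fin n × Fin p), S.card = k → t ∈ S →
    Reachable hm hn hp ⟨0, pos_of_three_le ‹_›⟩ S

variable {hm hn hp}

theorem ReachableWith.act {k : ℕ} {t : Fin n × Fin p} (h : ReachableWith hm hn hp k t) {x : ABC}
    (hx : x ≠ ABC.c) : ReachableWith hm hn hp k (actPair ABC.b (actPair x t)) := by
  intro S hS ht
  have h0 := h (preAct x (preAct ABC.b S))
    (by rw [card_preAct (by omega) hx, card_preAct (by omega) (by simp), hS])
    (mem_preAct.2 (mem_preAct.2 ht))
  have hx0 : actState x (⟨0, pos_of_three_le ‹_›⟩ : Fin m) = ⟨1, by omega⟩ := by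
    cases x
    · exact cyc_mk (by omega)
    · exact transp_zero (by omega)
    · exact absurd rfl hx
  have h1 := h0.of_preAct hx
    (by rw [hx0]; simp only [lastState, ne_eq, Fin.mk.injEq]; omega)
  rw [hx0] at h1
  have hb : actState ABC.b (⟨1, by omega⟩ : Fin m) = ⟨0, pos_of_three_le ‹_›⟩ :=
    transp_one (by omega)
  have h2 := h1.of_preAct (by simp)
    (by rw [hb]; simp only [lastState, ne_eq, Fin.mk.injEq]; omega)
  rwa [hb] at h2

theorem reachableWith_row_two_le {k : ℕ} {i : ℕ} (hi : 2 ≤ i) (hin : i + 1 < n)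
    (h : ∀ j, ReachableWith hm hn hp k (⟨i, by omega⟩, j)) (j : Fin p) :
    ReachableWith hm hn hp k (⟨i + 1, hin⟩, j) := by
  obtain ⟨j, rfl⟩ := cyc_surjective j
  have := (h j).act (x := ABC.a) (by simp)
  simp only [actPair] at this
  rwa [transp_of_two_le (by simpa using hi), cyc_mk hin] at this

theorem reachableWith_of_base {k : ℕ}
    (h : ReachableWith hm hn hp k (⟨1, by omega⟩, ⟨0, pos_of_three_le ‹_›⟩))
    (t : Fin n × Fin p) :
    ReachableWith hm hn hp k t := by
  have row_one : ∀ j, ReachableWith hm hn hp k (⟨1, by omega⟩, j) := by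
    refine cyc_induction _ h fun j hj => ?_
    have := hj.act (x := ABC.a) (by simp)
    simp only [actPair] at this
    rwa [transp_one (by omega), cyc_mk (by omega)] at this
  have row_three : ∀ (hn3 : 3 < n) j, ReachableWith hm hn hp k (⟨3, hn3⟩, j) := by
    intro hn3 j
    obtain ⟨j, rfl⟩ := cyc_surjective j
    obtain ⟨j, rfl⟩ := cyc_surjective j
    have := (row_one j).act (x := ABC.b) (by simp)
    simp only [actPair] at this
    rwa [cyc_mk (show 1 + 1 < n by omega), cyc_mk (show 1 + 1 + 1 < n by omega)] at this
  have rows : ∀ l (hl : 3 + l < n) j, ReachableWith hm hn hp k (⟨3 + l, hl⟩, j) := by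
    intro l
    induction l with
    | zero => exact row_three
    | succ l ih => exact fun hl => reachableWith_row_two_le (i := 3 + l) (by omega) hl (ih (by omega))
  have row_zero : ∀ j, ReachableWith hm hn hp k (⟨0, pos_of_three_le ‹_›⟩, j) := by
    intro j
    obtain ⟨j, rfl⟩ := cyc_surjective j
    rcases hn.eq_or_lt with rfl | hn3
    · obtain ⟨j, rfl⟩ := cyc_surjective j
      have hcyc : cyc (cyc (⟨1, by decide⟩ : Fin 3)) = ⟨0, by decide⟩ := by decide
      have := (row_one j).act (x := ABC.b) (by simp)
      simp only [actPair] at this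
      rwa [hcyc] at this
    · have := (rows (n - 4) (by omega) j).act (x := ABC.a) (by simp)
      simp only [actPair] at this
      rw [transp_of_two_le (by simp only; omega)] at this
      simp only [show 3 + (n - 4) = n - 1 by omega] at this
      rwa [cyc_last (by omega)] at this
  have row_two : ∀ j, ReachableWith hm hn hp k (⟨2, by omega⟩, j) := by
    intro j
    obtain ⟨j, rfl⟩ := cyc_surjective j
    have := (row_zero j).act (x := ABC.a) (by simp)
    simp only [actPair] at this
    rwa [transp_zero (by omega), cyc_mk (by omega)] at this
  obtain ⟨⟨i, hi⟩, j⟩ := t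
  match i, hi with
  | 0, _ => exact row_zero j
  | 1, _ => exact row_one j
  | 2, _ => exact row_two j
  | l + 3, hl =>
    have := rows l (by omega) j
    simpa only [Nat.add_comm 3 l] using this

theorem reachable_of_zero {k : ℕ}
    (h : ∀ S : Finset (Fin n × Fin p), S.card = k →
      Reachable hm hn hp ⟨0, pos_of_three_le ‹_›⟩ S)
    (i : ℕ) (hi : i + 1 < m) (S : Finset (Fin n × Fin p)) (hS : S.card = k) :
    Reachable hm hn hp ⟨i, by omega⟩ S := by
  induction i generalizing S with
  | zero => exact h S hS
  | succ i ih =>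
    have hcyc : actState ABC.a (⟨i, by omega⟩ : Fin m) = ⟨i + 1, by omega⟩ := cyc_mk (by omega)
    have := (ih (by omega) (preAct ABC.a S)
      (by rw [card_preAct (by omega) (by simp), hS])).of_preAct (by simp)
      (by rw [hcyc]; simp only [lastState, ne_eq, Fin.mk.injEq]; omega)
    rwa [hcyc] at this

variable (hm hn hp)

theorem reachable (q : Fin m) (S : Finset (Fin n × Fin p))
    (h : q = lastState hm → origin hn hp ∈ S) : Reachable hm hn hp q S := by
  obtain ⟨k, hk⟩ : ∃ k, S.card = k := ⟨_, rfl⟩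
  induction k generalizing q S with
  | zero =>
    obtain rfl := Finset.card_eq_zero.1 hk
    obtain ⟨i, hi⟩ := q
    have hi' : i + 1 < m := by
      by_contra hlast
      have := h (Fin.ext (by simp only [lastState]; omega))
      simp at this
    refine reachable_of_zero (k := 0) ?_ i hi' ∅ rfl
    intro S hS
    obtain rfl := Finset.card_eq_zero.1 hS
    exact ⟨[], concatDFA_start hm hn hp⟩
  | succ k ih =>
    have hlast : ∀ S : Finset (Fin n × Fin p), S.card = k + 1 → origin hn hp ∈ S →
        Reachable hm hn hp (lastState hm) S := by
      intro S hS h0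
      have hcyc : actState ABC.a (⟨m - 2, by omega⟩ : Fin m) = lastState hm := by
        refine (cyc_mk (by omega)).trans (Fin.ext ?_)
        simp only [lastState]
        omega
      have := (ih ⟨m - 2, by omega⟩ (preAct ABC.a (S.erase (origin hn hp)))
        (fun h => by simp only [lastState, Fin.mk.injEq] at h; omega)
        (by rw [card_preAct (by omega) (by simp), Finset.card_erase_of_mem h0, hS,
          Nat.add_sub_cancel])).of_preAct_erase (by simp) h0 hcyc
      rwa [hcyc] at this
    by_cases hq : q = lastState hm
    · exact hq ▸ hlast S hk (h hq)
    · have base : ReachableWith hm hn hp (k + 1) (⟨1, by omega⟩, ⟨0, pos_of_three_le ‹_›⟩) := by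
        intro S hS h1
        have hcyc : actState ABC.a (lastState hm) = ⟨0, pos_of_three_le ‹_›⟩ := cyc_last (by omega)
        have := (hlast (preAct ABC.a S) (by rw [card_preAct (by omega) (by simp), hS])
          (mem_preAct.2 (by
            simpa only [origin, actPair, transp_zero (show 1 < n by omega)] using h1))).of_preAct
          (by simp) (by rw [hcyc]; simp only [lastState, ne_eq, Fin.mk.injEq]; omega)
        rwa [hcyc] at this
      refine reachable_of_zero (k := k + 1) (fun T hT => ?_) q ?_ S hk
      · obtain ⟨t, ht⟩ := Finset.card_pos.1 (show 0 < T.card by omega)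
        exact reachableWith_of_base base t T hT ht
      · have : q.val ≠ m - 1 := fun h => hq (Fin.ext h)
        omega

/-! ### Counting the states -/

/-- The reachable states of the subset automaton. -/
def validStates : Finset (Fin m × Finset (Fin n × Fin p)) :=
  Finset.univ.filter fun s => s.1 = lastState hm → origin hn hp ∈ s.2

theorem mem_validStates {s : Fin m × Finset (Fin n × Fin p)} :
    s ∈ validStates hm hn hp ↔ (s.1 = lastState hm → origin hn hp ∈ s.2) := by
  simp [validStates]

theorem eval_mem_validStates (w : List ABC) :
    (concatDFA hm hn hp).eval w ∈ validStates hm hn hp := by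
  rw [mem_validStates]
  induction w using List.reverseRecOn with
  | nil =>
    rw [DFA.eval_nil, concatDFA_start]
    intro h
    simp only [lastState, Fin.mk.injEq] at h
    omega
  | append_singleton w x _ =>
    rw [DFA.eval_append_singleton, concatDFA_step_fst]
    exact fun h => (mem_concatDFA_step hm hn hp).2 (.inr ⟨h, rfl⟩)

theorem card_validStates :
    (validStates hm hn hp).card = (m - 1) * 2 ^ (n * p) + 2 ^ (n * p - 1) := by
  have hcompl : (Finset.univ : Finset (Fin m × Finset (Fin n × Fin p))) \ validStates hm hn hp =
      {lastState hm} ×ˢ (Finset.univ.erase (origin hn hp)).powerset := by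
    ext ⟨q, S⟩
    simp only [Finset.mem_sdiff, Finset.mem_univ, true_and, mem_validStates, Finset.mem_product,
      Finset.mem_singleton, Finset.mem_powerset, Finset.subset_erase, Finset.subset_univ]
    tauto
  have h1 := Finset.card_sdiff_add_card_eq_card (Finset.subset_univ (validStates hm hn hp))
  rw [hcompl, Finset.card_product, Finset.card_singleton, Finset.card_powerset,
    Finset.card_erase_of_mem (Finset.mem_univ _)] at h1
  simp only [Finset.card_univ, Fintype.card_prod, Fintype.card_finset, Fintype.card_fin] at h1
  obtain ⟨k, rfl⟩ : ∃ k, m = k + 1 := ⟨m - 1, by omega⟩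
  have hpos : 0 < n * p := by positivity
  obtain ⟨N, hN⟩ : ∃ N, n * p = N + 1 := ⟨n * p - 1, by omega⟩
  rw [hN] at h1 ⊢
  simp only [Nat.add_sub_cancel, add_mul, pow_succ] at h1 ⊢
  omega

end Concatenation

theorem statement10 (m n p : ℕ) (hm : 3 ≤ m) (hn : 3 ≤ n) (hp : 3 ≤ p) :
    sc ((XA m (by omega)).accepts * ((XB n (by omega)).accepts ⊓ (XC p (by omega)).accepts)) =
      (m - 1) * 2 ^ (n * p) + 2 ^ (n * p - 1) := by
  rw [← concatDFA_accepts hm hn hp, ← card_validStates hm hn hp]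
  refine sc_accepts_eq_card _ _ (eval_mem_validStates hm hn hp)
    (fun s hs => reachable hm hn hp s.1 s.2 ((mem_validStates hm hn hp).1 hs)) ?_
  rintro ⟨q, S⟩ - ⟨r, T⟩ - hne
  by_cases hqr : q = r
  · exact distinguishable_of_snd_ne hm hn hp fun hST => hne (by rw [hqr, hST])
  · exact distinguishable_of_fst_ne hm hn hp hqr
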